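/- Let h(x) = x / (0.1 + x + 2x²) and H(x) = k_f·h(x) + k_D·x with k_f ≥ 0 and k_D real. Then for all x₁, x₂ ≥ 3, |H(x₁) − H(x₂) − k_D·(x₁ − x₂)| ≤ (k_f/18)·|x₁ − x₂|. -/

import Mathlib

/-- For H(x) = k_f·h(x) + k_D·x with h(x) = x/(0.1 + x + 2x²) and k_f ≥ 0,
on [3, ∞) the increment of H differs from the linear increment k_D·(x₁ − x₂)
by at most (k_f/18)·|x₁ − x₂|. -/
theorem stmt_7 (kf kD : ℝ) (hkf : 0 ≤ kf) (x₁ x₂ : ℝ) (h₁ : 3 ≤ x₁) (h₂ : 3 ≤ x₂) :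
    |(kf * (x₁ / (0.1 + x₁ + 2 * x₁ ^ 2)) + kD * x₁) -
      (kf * (x₂ / (0.1 + x₂ + 2 * x₂ ^ 2)) + kD * x₂) - kD * (x₁ - x₂)| ≤
      (kf / 18) * |x₁ - x₂| := by
  have hp : 9 ≤ x₁ * x₂ := by nlinarith
  have hD₁ : 2 * x₁ ^ 2 ≤ 0.1 + x₁ + 2 * x₁ ^ 2 := by linarith
  have hD₂ : 2 * x₂ ^ 2 ≤ 0.1 + x₂ + 2 * x₂ ^ 2 := by linarith
  have hpos₁ : 0 < 0.1 + x₁ + 2 * x₁ ^ 2 := by positivity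
  have hpos₂ : 0 < 0.1 + x₂ + 2 * x₂ ^ 2 := by positivity
  have hD : 2 * x₁ ^ 2 * (2 * x₂ ^ 2) ≤
      (0.1 + x₁ + 2 * x₁ ^ 2) * (0.1 + x₂ + 2 * x₂ ^ 2) :=
    mul_le_mul hD₁ hD₂ (by positivity) hpos₁.le
  have hslope : |(0.1 - 2 * (x₁ * x₂)) /
      ((0.1 + x₁ + 2 * x₁ ^ 2) * (0.1 + x₂ + 2 * x₂ ^ 2))| ≤ 1 / 18 := by
    rw [abs_div, abs_of_pos (mul_pos hpos₁ hpos₂), abs_of_nonpos (by linarith),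
      div_le_iff₀ (mul_pos hpos₁ hpos₂)]
    nlinarith
  have hfactor : (kf * (x₁ / (0.1 + x₁ + 2 * x₁ ^ 2)) + kD * x₁) -
      (kf * (x₂ / (0.1 + x₂ + 2 * x₂ ^ 2)) + kD * x₂) - kD * (x₁ - x₂) =
      kf * ((0.1 - 2 * (x₁ * x₂)) /
        ((0.1 + x₁ + 2 * x₁ ^ 2) * (0.1 + x₂ + 2 * x₂ ^ 2))) * (x₁ - x₂) := by
    have hne₁ := hpos₁.ne'
    have hne₂ := hpos₂.ne'
    field_simp
    ring
  rw [hfactor, abs_mul, abs_mul, abs_of_nonneg hkf, div_eq_mul_one_div kf 18]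
  gcongr
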